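/- Assume ∫_{{‖ξ‖>1}} ‖ξ‖ m(dξ) < ∞, that ψ is jointly continuous on [0,∞) × S_d^+ with ψ(t,0) = 0 for all t ≥ 0, and that for each t ≥ 0 the map u ↦ ψ(t,u) is Fréchet differentiable on S_d^{++}. Let φ(t,u) = ∫_0^t F(ψ(s,u)) ds. Then the derivative Dφ(t,·) (which exists on S_d^{++}) has a jointly continuous extension to [0,∞) × S_d^+: there exists a jointly continuous map E : [0,∞) × S_d^+ → L(S_d,ℝ) such that E(t,u) is the Fréchet derivative of φ(t,·) at u for all t ≥ 0 and u ∈ S_d^{++}. -/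

import Mathlib

open MeasureTheory Matrix Filter Topology
open scoped ENNReal

attribute [local instance] Matrix.frobeniusNormedAddCommGroup Matrix.frobeniusNormedSpace

noncomputable section

/-- The space of real `d × d` matrices (the symmetric positive semidefinite ones are singled
out via `Matrix.PosSemidef`, which over `ℝ` includes symmetry). With the local Frobenius-norm
instance above, `‖·‖` is the Frobenius norm and `Matrix.trace (x * y)` is the associated trace
inner product. -/
abbrev Mat (d : ℕ) := Matrix (Fin d) (Fin d) ℝ

instance {d : ℕ} : MeasurableSpace (Mat d) :=
  (inferInstance : MeasurableSpace (Fin d → Fin d → ℝ))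

variable {d : ℕ}

/-- The trace inner product `⟨x, y⟩ = tr (x y)`. -/
def trIP (x y : Mat d) : ℝ := (x * y).trace

/-- The set `S_d^+ \ {0}` of nonzero symmetric positive semidefinite matrices. -/
def coneNZ (d : ℕ) : Set (Mat d) := {ξ | ξ.PosSemidef ∧ ξ ≠ 0}

/-- The (entrywise) integral `∫_{S_d^+ \ {0}} g(ξ) μ(dξ)` of a scalar function `g` against the
`S_d^+`-valued measure `μ(dξ) = ρ(ξ) ν(dξ)` represented by a base measure `ν` and a
matrix-valued density `ρ`. -/
def muInt (ν : Measure (Mat d)) (ρ : Mat d → Mat d) (g : Mat d → ℝ) : Mat d :=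
  Matrix.of fun i j => ∫ ξ in coneNZ d, g ξ * ρ ξ i j ∂ν

/-- `F(u) = ⟨b,u⟩ + ∫_{S_d^+ \ {0}} (1 - e^{-⟨u,ξ⟩}) m(dξ)`. -/
def Ffun (b : Mat d) (m : Measure (Mat d)) (u : Mat d) : ℝ :=
  trIP b u + ∫ ξ in coneNZ d, (1 - Real.exp (-(trIP u ξ))) ∂m

/-- `R(u) = -2uαu + Bᵀ(u) - ∫_{S_d^+ \ {0}} (e^{-⟨u,ξ⟩} - 1) μ(dξ)`, with `Bt = Bᵀ` and
`μ(dξ) = ρ(ξ) ν(dξ)`. -/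
def Rfun (α : Mat d) (Bt : Mat d →L[ℝ] Mat d) (ν : Measure (Mat d)) (ρ : Mat d → Mat d)
    (u : Mat d) : Mat d :=
  (-2 : ℝ) • (u * α * u) + Bt u - muInt ν ρ (fun ξ => Real.exp (-(trIP u ξ)) - 1)

/-- An admissible parameter set `(α, b, B, m, μ)`.  The `S_d^+`-valued σ-finite measure `μ` on
`S_d^+ \ {0}` is represented (via Radon–Nikodym) by its matrix-valued density `ρ` with respect
to a σ-finite base measure `ν`, so that `μ(dξ) = ρ(ξ) ν(dξ)` and
`tr(μ)(dξ) = tr(ρ(ξ)) ν(dξ)`; `Bt` denotes the adjoint `Bᵀ` of the linear drift `B` with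
respect to the trace inner product.  Measures on `S_d^+ \ {0}` are realized as measures on
matrix space, all integrals against them being taken over `coneNZ d`. -/
structure Admissible (d : ℕ) where
  /-- linear diffusion coefficient `α ∈ S_d^+` -/
  α : Mat d
  /-- constant drift `b ∈ S_d^+` -/
  b : Mat d
  /-- linear drift `B : S_d → S_d` -/
  B : Mat d →L[ℝ] Mat d
  /-- adjoint of the linear drift -/
  Bt : Mat d →L[ℝ] Mat d
  /-- constant jump term: a Borel measure `m` on `S_d^+ \ {0}` -/
  m : Measure (Mat d)
  /-- base measure of the linear jump coefficient `μ` -/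
  ν : Measure (Mat d)
  /-- matrix-valued density of `μ` with respect to `ν` -/
  ρ : Mat d → Mat d
  hα : α.PosSemidef
  hb : b.PosSemidef
  /-- `b ⪰ (d-1) α` -/
  hbα : (b - ((d : ℝ) - 1) • α).PosSemidef
  /-- `∫ (‖ξ‖ ∧ 1) m(dξ) < ∞` -/
  hm : IntegrableOn (fun ξ => min ‖ξ‖ 1) (coneNZ d) m
  hν : SigmaFinite ν
  hρmeas : Measurable ρ
  /-- `μ` is `S_d^+`-valued -/
  hρpsd : ∀ᵐ ξ ∂(ν.restrict (coneNZ d)), (ρ ξ).PosSemidef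
  /-- `∫ ‖ξ‖ tr(μ)(dξ) < ∞` -/
  hμint : IntegrableOn (fun ξ => ‖ξ‖ * (ρ ξ).trace) (coneNZ d) ν
  /-- `Bt` is the adjoint of `B` -/
  hadj : ∀ u x : Mat d, trIP u (B x) = trIP (Bt u) x
  /-- `⟨B(x),u⟩ ≥ 0` whenever `x, u ∈ S_d^+` with `⟨x,u⟩ = 0` -/
  hBpos : ∀ x u : Mat d, x.PosSemidef → u.PosSemidef → trIP x u = 0 → 0 ≤ trIP (B x) u

/-- `ψ` solves the generalized Riccati equation `∂_t ψ(t,u) = R(ψ(t,u))`, `ψ(0,u) = u`,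
staying in `S_d^+` for initial conditions in `S_d^+`. -/
def IsRiccati (P : Admissible d) (ψ : ℝ → Mat d → Mat d) : Prop :=
  (∀ u : Mat d, u.PosSemidef → ψ 0 u = u) ∧
  (∀ t : ℝ, 0 ≤ t → ∀ u : Mat d, u.PosSemidef → (ψ t u).PosSemidef) ∧
  (∀ u : Mat d, u.PosSemidef → ∀ t ∈ Set.Ici (0 : ℝ),
    HasDerivWithinAt (fun s => ψ s u) (Rfun P.α P.Bt P.ν P.ρ (ψ t u)) (Set.Ici 0) t)

/-- `φ(t,u) = ∫_0^t F(ψ(s,u)) ds`. -/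
def phiFun (P : Admissible d) (ψ : ℝ → Mat d → Mat d) (t : ℝ) (u : Mat d) : ℝ :=
  ∫ s in (0 : ℝ)..t, Ffun P.b P.m (ψ s u)

/-- `p t x` is a family of Borel probability measures supported on `S_d^+` satisfying the
affine transform formula
`∫ e^{-⟨u,ξ⟩} p_t(x,dξ) = exp (-φ(t,u) - ⟨ψ(t,u),x⟩)`. -/
def IsAffineKernel (P : Admissible d) (ψ : ℝ → Mat d → Mat d)
    (p : ℝ → Mat d → Measure (Mat d)) : Prop :=
  (∀ t : ℝ, 0 ≤ t → ∀ x : Mat d, x.PosSemidef → IsProbabilityMeasure (p t x)) ∧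
  (∀ t : ℝ, 0 ≤ t → ∀ x : Mat d, x.PosSemidef → p t x {ξ : Mat d | ¬ ξ.PosSemidef} = 0) ∧
  (∀ t : ℝ, 0 ≤ t → ∀ u x : Mat d, u.PosSemidef → x.PosSemidef →
    ∫ ξ, Real.exp (-(trIP u ξ)) ∂(p t x) =
      Real.exp (-(phiFun P ψ t u) - trIP (ψ t u) x))

/-- `Bt2` is the effective drift `B̃(u) = B(u) + ∫_{S_d^+ \ {0}} ⟨ξ,u⟩ μ(dξ)`, given as a
(continuous) linear map so that its operator exponential can be formed. -/
def IsEffectiveDrift (P : Admissible d) (Bt2 : Mat d →L[ℝ] Mat d) : Prop :=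
  ∀ u : Mat d, Bt2 u = P.B u + muInt P.ν P.ρ (fun ξ => trIP ξ u)

/-- Weak convergence of `q t` to `π` as `t → ∞`: convergence of integrals of all bounded
continuous functions. -/
def WeakTendsto (q : ℝ → Measure (Mat d)) (π : Measure (Mat d)) : Prop :=
  ∀ f : BoundedContinuousFunction (Mat d) ℝ,
    Tendsto (fun t => ∫ ξ, f ξ ∂(q t)) atTop (𝓝 (∫ ξ, f ξ ∂π))

section AbstractPart

/-- Picard iterates for the linear equation. -/
def picIter {X 𝔸 : Type*} [NormedRing 𝔸] [NormedAlgebra ℝ 𝔸] (C : ℝ → X → 𝔸) : ℕ → ℝ → X → 𝔸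
  | 0 => fun _ _ => 1
  | (n + 1) => fun t x => ∫ s in (0 : ℝ)..t, C s x * picIter C n s x

theorem picIter_continuous {X 𝔸 : Type*} [TopologicalSpace X] [NormedRing 𝔸] [NormedAlgebra ℝ 𝔸]
    (C : ℝ → X → 𝔸) (hC : Continuous (fun q : ℝ × X => C q.1 q.2)) (n : ℕ) :
    Continuous (fun q : ℝ × X => picIter C n q.1 q.2) := by
  induction n with
  | zero => exact continuous_const
  | succ n ih =>
    simp only [picIter]
    refine intervalIntegral.continuous_parametric_intervalIntegral_of_continuous
      (f := fun (q : ℝ × X) s => C s q.2 * picIter C n s q.2) (s := fun q => q.1) ?_ continuous_fst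
    have h1 : Continuous (fun p : (ℝ × X) × ℝ => (p.2, p.1.2)) := by fun_prop
    exact (hC.comp h1).mul (ih.comp h1)

theorem picIter_bound {X 𝔸 : Type*} [TopologicalSpace X] [NormedRing 𝔸] [NormedAlgebra ℝ 𝔸]
    (C : ℝ → X → 𝔸) (T L : ℝ) (x : X)
    (hL : ∀ s ∈ Set.Icc 0 T, ‖C s x‖ ≤ L) (n : ℕ) :
    ∀ t ∈ Set.Icc 0 T, ‖picIter C n t x‖ ≤ ‖(1 : 𝔸)‖ * ((L * t) ^ n / n.factorial) := by
  induction n with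
  | zero => intro t ht; simp [picIter]
  | succ n ih =>
    intro t ht
    have hL0 : 0 ≤ L := (norm_nonneg _).trans (hL t ht)
    simp only [picIter]
    have hIntEq : ∫ s in (0 : ℝ)..t, L * (‖(1 : 𝔸)‖ * ((L * s) ^ n / n.factorial)) =
        ‖(1 : 𝔸)‖ * ((L * t) ^ (n + 1) / (n + 1).factorial) := by
      have : (fun s : ℝ => L * (‖(1 : 𝔸)‖ * ((L * s) ^ n / n.factorial))) =
          fun s => (L ^ (n + 1) * ‖(1 : 𝔸)‖ / n.factorial) * s ^ n := by
        funext s; rw [mul_pow]; ring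
      rw [this, intervalIntegral.integral_const_mul, integral_pow, Nat.factorial_succ]
      have : (n.factorial : ℝ) ≠ 0 := by positivity
      push_cast
      field_simp
      ring
    rw [← hIntEq]
    refine intervalIntegral.norm_integral_le_of_norm_le ht.1 ?_ ?_
    · refine Eventually.of_forall fun s hs => ?_
      have hs' : s ∈ Set.Icc 0 T := ⟨hs.1.le, hs.2.trans ht.2⟩
      exact (norm_mul_le _ _).trans (mul_le_mul (hL s hs') (ih s hs') (norm_nonneg _) hL0)
    · apply Continuous.intervalIntegrable
      fun_prop

theorem linODE {X 𝔸 : Type*} [TopologicalSpace X] [LocallyCompactSpace X]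
    [NormedRing 𝔸] [NormedAlgebra ℝ 𝔸] [CompleteSpace 𝔸]
    (C : ℝ → X → 𝔸) (hC : Continuous (fun q : ℝ × X => C q.1 q.2)) :
    ∃ A : ℝ → X → 𝔸, Continuous (fun q : ℝ × X => A q.1 q.2) ∧ (∀ x, A 0 x = 1) ∧
      ∀ x, ∀ t, 0 ≤ t → HasDerivWithinAt (fun s => A s x) (C t x * A t x) (Set.Ici t) t := by
  have hbd : ∀ (T : ℝ) (S : Set X), IsCompact S → ∃ L, ∀ x ∈ S, ∀ s ∈ Set.Icc 0 T,
      ‖C s x‖ ≤ L := by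
    intro T S hS
    obtain ⟨L, hL⟩ := ((isCompact_Icc (a := (0 : ℝ)) (b := T)).prod hS).exists_bound_of_continuousOn
      hC.continuousOn
    exact ⟨L, fun x hx s hs => hL (s, x) ⟨hs, hx⟩⟩
  have hsum : ∀ r : ℝ, Summable fun n : ℕ => ‖(1 : 𝔸)‖ * (r ^ n / n.factorial) := fun r =>
    (Real.summable_pow_div_factorial r).mul_left _
  have hbound : ∀ (T : ℝ) (S : Set X), IsCompact S → ∃ r, ∀ x ∈ S, ∀ t ∈ Set.Icc 0 T, ∀ n,
      ‖picIter C n t x‖ ≤ ‖(1 : 𝔸)‖ * (r ^ n / n.factorial) := by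
    intro T S hS
    obtain ⟨L, hL⟩ := hbd T S hS
    refine ⟨L * T, fun x hx t ht n => ?_⟩
    have hL0 : 0 ≤ L := (norm_nonneg _).trans (hL x hx t ht)
    refine (picIter_bound C T L x (hL x hx) n t ht).trans ?_
    have := mul_nonneg hL0 ht.1
    gcongr
    exact ht.2
  set A : ℝ → X → 𝔸 := fun t x => ∑' n, picIter C n (max t 0) x with hA
  have hAcont : Continuous (fun q : ℝ × X => A q.1 q.2) := by
    rw [continuous_iff_continuousAt]
    rintro ⟨t0, x0⟩
    obtain ⟨S, hS, hSx⟩ := exists_compact_mem_nhds x0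
    obtain ⟨r, hr⟩ := hbound (max (t0 + 1) 0) S hS
    have hon : ContinuousOn (fun q : ℝ × X => A q.1 q.2) (Set.Iio (t0 + 1) ×ˢ S) := by
      refine continuousOn_tsum (f := fun (n : ℕ) (q : ℝ × X) => picIter C n (max q.1 0) q.2)
        (u := fun n : ℕ => ‖(1 : 𝔸)‖ * (r ^ n / n.factorial)) ?_ (hsum r) ?_
      · intro n
        have h1 : Continuous (fun q : ℝ × X => (max q.1 0, q.2)) := by fun_prop
        exact ((picIter_continuous C hC n).comp h1).continuousOn
      · rintro n ⟨t, x⟩ ⟨ht, hx⟩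
        have ht' : t < t0 + 1 := ht
        have hm : max t 0 ∈ Set.Icc 0 (max (t0 + 1) 0) :=
          ⟨le_max_right t 0, max_le_max ht'.le (le_refl 0)⟩
        exact hr x hx (max t 0) hm n
    refine hon.continuousAt (prod_mem_nhds (Iio_mem_nhds (by linarith)) hSx)
  have hcx : ∀ x, Continuous fun s => C s x * A s x := by
    intro x
    have h1 : Continuous (fun s : ℝ => (s, x)) := by fun_prop
    exact (hC.comp h1).mul (hAcont.comp h1)
  have hCx : ∀ x, Continuous fun s => C s x := by
    intro x
    have h1 : Continuous (fun s : ℝ => (s, x)) := by fun_prop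
    exact hC.comp h1
  have hPx : ∀ n x, Continuous fun s => picIter C n s x := by
    intro n x
    have h1 : Continuous (fun s : ℝ => (s, x)) := by fun_prop
    exact (picIter_continuous C hC n).comp h1
  have hIntEq : ∀ x t, 0 ≤ t → A t x = 1 + ∫ s in (0 : ℝ)..t, C s x * A s x := by
    intro x t ht
    obtain ⟨r, hr⟩ := hbound t {x} isCompact_singleton
    obtain ⟨L, hL⟩ := hbd t {x} isCompact_singleton
    have hr := hr x rfl
    have hL := hL x rfl
    have hs : ∀ s ∈ Set.Icc 0 t, Summable fun n => picIter C n s x := fun s hs =>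
      Summable.of_norm_bounded (hsum r) (hr s hs)
    have hH : HasSum (fun n => ∫ s in (0 : ℝ)..t, C s x * picIter C n s x)
        (∫ s in (0 : ℝ)..t, C s x * A s x) := by
      refine intervalIntegral.hasSum_integral_of_dominated_convergence
        (fun n _ => L * (‖(1 : 𝔸)‖ * (r ^ n / n.factorial))) ?_ ?_ ?_ ?_ ?_
      · intro n
        exact ((hCx x).mul (hPx n x)).aestronglyMeasurable
      · intro n
        refine Eventually.of_forall fun s hs => ?_
        rw [Set.uIoc_of_le ht] at hs
        have hs' : s ∈ Set.Icc 0 t := ⟨hs.1.le, hs.2⟩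
        exact (norm_mul_le _ _).trans (mul_le_mul (hL s hs') (hr s hs' n) (norm_nonneg _)
          ((norm_nonneg _).trans (hL s hs')))
      · exact Eventually.of_forall fun s hs => (hsum r).mul_left L
      · exact intervalIntegrable_const
      · refine Eventually.of_forall fun s hs' => ?_
        rw [Set.uIoc_of_le ht] at hs'
        have := (hs s ⟨hs'.1.le, hs'.2⟩).hasSum.mul_left (C s x)
        simpa [hA, max_eq_left hs'.1.le] using this
    have h2 := (hs t ⟨ht, le_rfl⟩).tsum_eq_zero_add
    simp only [hA, max_eq_left ht]
    rw [h2, ← hH.tsum_eq]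
    rfl
  refine ⟨A, hAcont, fun x => by simpa using hIntEq x 0 le_rfl, fun x t ht => ?_⟩
  have hd : HasDerivAt (fun s => 1 + ∫ s in (0 : ℝ)..s, C s x * A s x) (C t x * A t x) t :=
    ((hcx x).integral_hasStrictDerivAt 0 t).hasDerivAt.const_add _
  exact hd.hasDerivWithinAt.congr (fun s hs => hIntEq x s (ht.trans hs)) (hIntEq x t ht)

theorem abstract_main {V : Type*} [NormedAddCommGroup V] [NormedSpace ℝ V] [FiniteDimensional ℝ V]
    (K : Set V) (hK : IsClosed K) (R : V → V) (F : V → ℝ)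
    (M : K → K → V →ₗ[ℝ] V) (hM : ∀ h, Continuous fun p : K × K => M p.1 p.2 h)
    (hRM : ∀ v w : K, R v - R w = M v w ((v : V) - w))
    (N : K → K → V →ₗ[ℝ] ℝ) (hN : ∀ h, Continuous fun p : K × K => N p.1 p.2 h)
    (hFN : ∀ v w : K, F v - F w = N v w ((v : V) - w))
    (ψ : ℝ → V → V) (h0 : ∀ u ∈ K, ψ 0 u = u) (hψK : ∀ t, 0 ≤ t → ∀ u ∈ K, ψ t u ∈ K)
    (hψ' : ∀ u ∈ K, ∀ t ∈ Set.Ici (0 : ℝ),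
      HasDerivWithinAt (fun s => ψ s u) (R (ψ t u)) (Set.Ici 0) t)
    (hcont : ContinuousOn (fun q : ℝ × V => ψ q.1 q.2) (Set.Ici 0 ×ˢ K)) :
    ∃ E : ℝ → V → (V →L[ℝ] ℝ),
      ContinuousOn (fun q : ℝ × V => E q.1 q.2) (Set.Ici 0 ×ˢ K) ∧
      ∀ t : ℝ, 0 ≤ t → ∀ u ∈ K,
        HasFDerivWithinAt (fun v => ∫ s in (0 : ℝ)..t, F (ψ s v)) (E t u) K u := by
  have : ProperSpace V := FiniteDimensional.proper_real V
  have : CompleteSpace V := FiniteDimensional.complete ℝ V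
  have : LocallyCompactSpace K := hK.isClosedEmbedding_subtypeVal.locallyCompactSpace
  set Mc : K × K → (V →L[ℝ] V) := fun p => LinearMap.toContinuousLinearMap (M p.1 p.2) with hMc
  have hMcc : Continuous Mc := continuous_clm_apply.2 hM
  set Nc : K × K → (V →L[ℝ] ℝ) := fun p => LinearMap.toContinuousLinearMap (N p.1 p.2) with hNc
  have hNcc : Continuous Nc := continuous_clm_apply.2 hN
  set Ψ : ℝ → K → K := fun t u => ⟨ψ (max t 0) u, hψK _ (le_max_right _ _) _ u.2⟩ with hΨ
  have hΨc : Continuous fun q : ℝ × K => Ψ q.1 q.2 := by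
    refine Continuous.subtype_mk ?_ _
    refine hcont.comp_continuous (f := fun q : ℝ × K => (max q.1 0, (q.2 : V))) (by fun_prop) ?_
    exact fun q => ⟨le_max_right q.1 0, q.2.2⟩
  have hΨ2 : Continuous fun q : ℝ × (K × K) => (Ψ q.1 q.2.1, Ψ q.1 q.2.2) :=
    (hΨc.comp (f := fun q : ℝ × (K × K) => (q.1, q.2.1)) (by fun_prop)).prodMk
      (hΨc.comp (f := fun q : ℝ × (K × K) => (q.1, q.2.2)) (by fun_prop))
  obtain ⟨A, hAc, hA0, hA'⟩ := linODE (X := K × K) (fun t p => Mc (Ψ t p.1, Ψ t p.2))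
    (hMcc.comp hΨ2)
  -- the difference identity for ψ
  have hdiff : ∀ v w : K, ∀ t, 0 ≤ t → ψ t v - ψ t w = A t (v, w) ((v : V) - w) := by
    intro v w t ht
    have hcc : Continuous fun s : ℝ => Mc (Ψ s v, Ψ s w) :=
      (hMcc.comp hΨ2).comp (f := fun s : ℝ => (s, (v, w))) (by fun_prop)
    obtain ⟨L, hL⟩ := (isCompact_Icc (a := (0 : ℝ)) (b := t)).exists_bound_of_continuousOn
      hcc.continuousOn
    have hψd : ∀ s, 0 ≤ s → HasDerivWithinAt (fun s => ψ s v - ψ s w)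
        (Mc (Ψ s v, Ψ s w) (ψ s v - ψ s w)) (Set.Ici 0) s := by
      intro s hs
      have h1 := (hψ' v v.2 s hs).sub (hψ' w w.2 s hs)
      have h2 := hRM (Ψ s v) (Ψ s w)
      simp only [hΨ, max_eq_left hs] at h2
      rw [h2] at h1
      simp only [hMc, hΨ, max_eq_left hs]
      exact h1
    have hAd : ∀ s, 0 ≤ s → HasDerivWithinAt (fun s => A s (v, w) ((v : V) - w))
        (Mc (Ψ s v, Ψ s w) (A s (v, w) ((v : V) - w))) (Set.Ici s) s := by
      intro s hs
      have := (hA' (v, w) s hs).clm_apply (hasDerivWithinAt_const s (Set.Ici s) ((v : V) - w))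
      simpa using this
    have hu := ODE_solution_unique_of_mem_Icc_right (K := L.toNNReal) (a := 0) (b := t)
      (v := fun s y => Mc (Ψ s v, Ψ s w) y) (s := fun _ => Set.univ)
      (f := fun s => ψ s v - ψ s w) (g := fun s => A s (v, w) ((v : V) - w))
      (fun s hs => by
        refine ((Mc (Ψ s v, Ψ s w)).lipschitz.weaken ?_).lipschitzOnWith
        exact NNReal.le_toNNReal_of_coe_le (hL s ⟨hs.1, hs.2.le⟩))
      (fun s hs => ((hψd s hs.1).continuousWithinAt).mono (fun x hx => hx.1))
      (fun s hs => (hψd s hs.1).mono (Set.Ici_subset_Ici.2 hs.1))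
      (fun _ _ => trivial)
      (by
        have : Continuous fun s : ℝ => A s (v, w) :=
          hAc.comp (f := fun s : ℝ => (s, (v, w))) (by fun_prop)
        exact (this.clm_apply continuous_const).continuousOn)
      (fun s hs => hAd s hs.1)
      (fun _ _ => trivial)
      (by simp [hA0, h0 v v.2, h0 w w.2])
    exact hu ⟨ht, le_rfl⟩
  set H : ℝ → K × K → (V →L[ℝ] ℝ) := fun s p => (Nc (Ψ s p.1, Ψ s p.2)).comp (A s p) with hH
  have hHc : Continuous fun q : ℝ × (K × K) => H q.1 q.2 := (hNcc.comp hΨ2).clm_comp hAc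
  set G : ℝ → K × K → (V →L[ℝ] ℝ) := fun t p => ∫ s in (0 : ℝ)..t, H s p with hG
  have hGc : Continuous fun q : ℝ × (K × K) => G q.1 q.2 := by
    refine intervalIntegral.continuous_parametric_intervalIntegral_of_continuous
      (f := fun (q : ℝ × (K × K)) s => H s q.2) (s := fun q => q.1) ?_ continuous_fst
    exact hHc.comp (f := fun p : (ℝ × (K × K)) × ℝ => (p.2, p.1.2)) (by fun_prop)
  have hFc : Continuous fun v : K => F v := by
    rw [continuous_iff_continuousAt]
    intro w
    have h1 : (fun v : K => F v) = fun v : K => F w + Nc (v, w) ((v : V) - w) := by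
      funext v
      have := hFN v w
      simp only [hNc, LinearMap.coe_toContinuousLinearMap']
      linarith
    rw [h1]
    have : Continuous fun v : K => F w + Nc (v, w) ((v : V) - w) := by
      refine continuous_const.add (Continuous.clm_apply ?_ (by fun_prop))
      exact hNcc.comp (f := fun v : K => (v, w)) (by fun_prop)
    exact this.continuousAt
  have hFi : ∀ (v : K) (t : ℝ), 0 ≤ t → IntervalIntegrable (fun s => F (ψ s v)) volume 0 t := by
    intro v t ht
    have h1 : Continuous fun s => F (Ψ s v) :=
      hFc.comp (hΨc.comp (f := fun s : ℝ => (s, v)) (by fun_prop))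
    refine (h1.intervalIntegrable (μ := volume) 0 t).congr ?_
    intro s hs
    rw [Set.uIoc_of_le ht] at hs
    simp [hΨ, max_eq_left hs.1.le]
  have hφ : ∀ (v w : K) (t : ℝ), 0 ≤ t → (∫ s in (0 : ℝ)..t, F (ψ s v)) -
      (∫ s in (0 : ℝ)..t, F (ψ s w)) = G t (v, w) ((v : V) - w) := by
    intro v w t ht
    rw [← intervalIntegral.integral_sub (hFi v t ht) (hFi w t ht)]
    have hHi : IntervalIntegrable (fun s => H s (v, w)) volume 0 t :=
      (hHc.comp (f := fun s : ℝ => (s, (v, w))) (by fun_prop)).intervalIntegrable _ _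
    rw [hG]
    simp only
    rw [ContinuousLinearMap.intervalIntegral_apply hHi]
    refine intervalIntegral.integral_congr fun s hs => ?_
    rw [Set.uIcc_of_le ht] at hs
    have h1 := hFN (Ψ s v) (Ψ s w)
    have h2 := hdiff v w s hs.1
    simp only [hΨ, max_eq_left hs.1] at h1
    simp only [hH, hNc, ContinuousLinearMap.comp_apply, ← h2, h1,
      LinearMap.coe_toContinuousLinearMap', hΨ, max_eq_left hs.1]
  classical
  refine ⟨fun t u => if h : u ∈ K then G t (⟨u, h⟩, ⟨u, h⟩) else 0, ?_, ?_⟩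
  · rw [continuousOn_iff_continuous_domRestrict]
    have h1 : Continuous fun q : (Set.Ici (0 : ℝ) ×ˢ K : Set (ℝ × V)) =>
        G q.1.1 (⟨q.1.2, q.2.2⟩, ⟨q.1.2, q.2.2⟩) := by
      refine hGc.comp (f := fun q : (Set.Ici (0 : ℝ) ×ˢ K : Set (ℝ × V)) =>
        (q.1.1, ((⟨q.1.2, q.2.2⟩ : K), (⟨q.1.2, q.2.2⟩ : K)))) ?_
      fun_prop
    convert h1 using 1
    funext q
    have := q.2.2
    simp only [Set.domRestrict_apply, dif_pos this]
  · intro t ht u hu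
    simp only [dif_pos hu]
    rw [hasFDerivWithinAt_iff_isLittleO, Asymptotics.isLittleO_iff]
    intro c hc
    have h1 : Continuous fun v : K => G t (v, ⟨u, hu⟩) :=
      hGc.comp (f := fun v : K => (t, (v, (⟨u, hu⟩ : K)))) (by fun_prop)
    have h2 := Metric.continuousAt_iff.1 (h1.continuousAt (x := ⟨u, hu⟩)) c hc
    obtain ⟨δ, hδ, h2⟩ := h2
    filter_upwards [self_mem_nhdsWithin, mem_nhdsWithin_of_mem_nhds (Metric.ball_mem_nhds u hδ)]
      with v hv hvb
    have h3 := hφ ⟨v, hv⟩ ⟨u, hu⟩ t ht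
    simp only at h3
    rw [h3, ← _root_.sub_apply]
    refine (ContinuousLinearMap.le_opNorm _ _).trans ?_
    gcongr
    rw [← dist_eq_norm]
    exact (h2 (x := ⟨v, hv⟩) hvb).le

end AbstractPart

section ConcretePart

/-- The Hadamard kernel of `x ↦ 1 - e^{-x}`. -/
def gk (a b : ℝ) : ℝ := Real.exp (-b) * dslope (fun x : ℝ => 1 - Real.exp (-x)) 0 (a - b)

theorem gk_eq (a b : ℝ) : (a - b) * gk a b = (1 - Real.exp (-a)) - (1 - Real.exp (-b)) := by
  have h := sub_smul_dslope (fun x : ℝ => 1 - Real.exp (-x)) 0 (a - b)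
  simp only [smul_eq_mul, sub_zero, neg_zero, Real.exp_zero, sub_self] at h
  have h2 : Real.exp (-a) = Real.exp (-b) * Real.exp (-(a - b)) := by
    rw [← Real.exp_add]; ring_nf
  unfold gk
  rw [mul_left_comm, h, h2]
  ring

theorem gk_continuous : Continuous fun p : ℝ × ℝ => gk p.1 p.2 := by
  have h : Continuous (dslope (fun x : ℝ => 1 - Real.exp (-x)) 0) := by
    rw [← continuousOn_univ, continuousOn_dslope univ_mem]
    exact ⟨by fun_prop, by fun_prop⟩
  unfold gk
  exact (by fun_prop : Continuous fun p : ℝ × ℝ => Real.exp (-p.2)).mul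
    (h.comp (by fun_prop : Continuous fun p : ℝ × ℝ => p.1 - p.2))

theorem exp_diff_bound {a b : ℝ} (hb : 0 ≤ b) (hab : b ≤ a) :
    |(1 - Real.exp (-a)) - (1 - Real.exp (-b))| ≤ a - b := by
  have h2 : Real.exp (-a) = Real.exp (-b) * Real.exp (-(a - b)) := by
    rw [← Real.exp_add]; ring_nf
  have h3 := Real.add_one_le_exp (-(a - b))
  have h4 : Real.exp (-b) ≤ 1 := Real.exp_le_one_iff.2 (by linarith)
  have h5 := Real.exp_pos (-b)
  have h6 : Real.exp (-(a - b)) ≤ 1 := Real.exp_le_one_iff.2 (by linarith)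
  rw [abs_le]
  constructor <;> rw [h2] <;> nlinarith

theorem gk_bound {a b : ℝ} (ha : 0 ≤ a) (hb : 0 ≤ b) : |gk a b| ≤ 1 := by
  rcases eq_or_ne a b with rfl | hne
  · have hd : deriv (fun x : ℝ => 1 - Real.exp (-x)) 0 = 1 := by
      have : HasDerivAt (fun x : ℝ => 1 - Real.exp (-x)) (-(Real.exp (-0) * (-1))) 0 :=
        ((hasDerivAt_neg (0 : ℝ)).exp).const_sub 1
      rw [this.deriv]; simp
    simp only [gk, sub_self, dslope_same, hd, mul_one]
    rw [abs_of_pos (Real.exp_pos _)]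
    exact Real.exp_le_one_iff.2 (by linarith)
  · have h1 : |a - b| * |gk a b| ≤ |a - b| := by
      rw [← abs_mul, gk_eq]
      rcases le_total b a with h | h
      · exact (exp_diff_bound hb h).trans (le_abs_self _)
      · rw [abs_sub_comm, abs_sub_comm a b]
        exact (exp_diff_bound ha h).trans (le_abs_self _)
    have h2 : 0 < |a - b| := abs_pos.2 (sub_ne_zero.2 hne)
    exact le_of_mul_le_mul_left (by linarith) h2

theorem trIP_eq_sum (x y : Mat d) : trIP x y = ∑ k, ∑ l, x k l * y l k := by
  simp [trIP, Matrix.trace, Matrix.mul_apply]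

theorem trIP_nonneg {x y : Mat d} (hx : x.PosSemidef) (hy : y.PosSemidef) : 0 ≤ trIP x y := by
  obtain ⟨m, A, hA⟩ := Matrix.posSemidef_iff_eq_sum_vecMulVec.mp hy
  rw [trIP, hA, Matrix.mul_sum, Matrix.trace_sum]
  refine Finset.sum_nonneg fun i _ => ?_
  rw [Matrix.mul_vecMulVec, Matrix.trace_vecMulVec, dotProduct_comm]
  exact (Matrix.posSemidef_iff_dotProduct_mulVec.1 hx).2 _

theorem entry_le_norm (x : Mat d) (k l : Fin d) : |x k l| ≤ ‖x‖ := by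
  rw [Matrix.frobenius_norm_def, ← Real.sqrt_eq_rpow]
  refine Real.le_sqrt_of_sq_le ?_
  have h1 : ‖x k l‖ ^ 2 ≤ ∑ j, ‖x k j‖ ^ 2 :=
    Finset.single_le_sum (f := fun j => ‖x k j‖ ^ 2) (fun _ _ => by positivity) (Finset.mem_univ l)
  have h2 : ∑ j, ‖x k j‖ ^ 2 ≤ ∑ i, ∑ j, ‖x i j‖ ^ 2 :=
    Finset.single_le_sum (f := fun i => ∑ j, ‖x i j‖ ^ 2) (fun _ _ => by positivity)
      (Finset.mem_univ k)
  have h3 : |x k l| ^ 2 = ‖x k l‖ ^ 2 := rfl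
  rw [h3]
  exact_mod_cast h1.trans h2

theorem entry_le_trace {x : Mat d} (hx : x.PosSemidef) (i j : Fin d) : |x i j| ≤ x.trace := by
  have hdiag : ∀ k, 0 ≤ x k k := fun k => hx.diag_nonneg
  have hle : ∀ k, x k k ≤ x.trace := fun k =>
    Finset.single_le_sum (f := fun k => x k k) (fun k _ => hdiag k) (Finset.mem_univ k)
  have hsym : x j i = x i j := by simpa using hx.1.apply i j
  have hq : ∀ c : ℝ, 0 ≤ x i i + c * x i j + c * (x j i) + c * c * x j j := by
    intro c
    have := (Matrix.posSemidef_iff_dotProduct_mulVec.1 hx).2 (Pi.single i 1 + Pi.single j c)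
    simp [Matrix.mulVec_add, add_dotProduct, dotProduct_add] at this
    linarith
  have h1 := hq 1
  have h2 := hq (-1)
  have := hle i
  have := hle j
  rw [abs_le]
  constructor <;> linarith

theorem measurable_entry (k l : Fin d) : Measurable fun ξ : Mat d => ξ k l :=
  (measurable_pi_apply l).comp (measurable_pi_apply k)

theorem continuous_entry (k l : Fin d) : Continuous fun ξ : Mat d => ξ k l :=
  continuous_id.matrix_elem k l

theorem measurable_norm_mat : Measurable fun ξ : Mat d => ‖ξ‖ := by
  simp only [Matrix.frobenius_norm_def]
  have : Measurable fun ξ : Mat d => ∑ i, ∑ j, ‖ξ i j‖ ^ (2 : ℝ) :=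
    Finset.measurable_sum _ fun i _ => Finset.measurable_sum _ fun j _ =>
      ((measurable_entry i j).norm).pow_const _
  exact this.pow_const _

theorem isClosed_psd : IsClosed {u : Mat d | u.PosSemidef} := by
  have : {u : Mat d | u.PosSemidef} = {u : Mat d | uᴴ = u} ∩
      ⋂ x : Fin d → ℝ, {u : Mat d | 0 ≤ star x ⬝ᵥ (u *ᵥ x)} := by
    ext u
    simp only [Matrix.posSemidef_iff_dotProduct_mulVec, Set.mem_ofPred_eq, Set.mem_inter_iff,
      Set.mem_iInter]
    rfl
  rw [this]
  refine (isClosed_eq (by fun_prop) (by fun_prop)).inter (isClosed_iInter fun x => ?_)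
  exact isClosed_le (by fun_prop) (by fun_prop)

theorem measurableSet_psd : MeasurableSet {u : Mat d | u.PosSemidef} := by
  have : BorelSpace (Mat d) := inferInstanceAs (BorelSpace (Fin d → Fin d → ℝ))
  exact isClosed_psd.measurableSet

theorem measurableSet_coneNZ : MeasurableSet (coneNZ d) := by
  have : MeasurableSet ({0} : Set (Mat d)) := by
    have : MeasurableSingletonClass (Mat d) :=
      inferInstanceAs (MeasurableSingletonClass (Fin d → Fin d → ℝ))
    exact measurableSet_singleton _
  exact measurableSet_psd.inter this.compl

theorem measurable_trIP (u : Mat d) : Measurable fun ξ : Mat d => trIP u ξ := by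
  simp only [trIP_eq_sum]
  exact Finset.measurable_sum _ fun i _ => Finset.measurable_sum _ fun j _ =>
    (measurable_entry j i).const_mul _

theorem continuous_trIP (ξ : Mat d) : Continuous fun u : Mat d => trIP u ξ := by
  simp only [trIP_eq_sum]
  exact continuous_finsetSum _ fun i _ => continuous_finsetSum _ fun j _ =>
    (continuous_entry i j).mul continuous_const

/-- The coefficient integrals. -/
def Tco (κ : Measure (Mat d)) (q : Mat d → ℝ) (v w : Mat d) (k l : Fin d) : ℝ :=
  ∫ ξ in coneNZ d, gk (trIP v ξ) (trIP w ξ) * ξ l k * q ξ ∂κ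

theorem Tco_meas (κ : Measure (Mat d)) (q : Mat d → ℝ) (hq : Measurable q) (v w : Mat d)
    (k l : Fin d) : AEStronglyMeasurable
      (fun ξ => gk (trIP v ξ) (trIP w ξ) * ξ l k * q ξ) (κ.restrict (coneNZ d)) := by
  have h1 : Measurable fun ξ => gk (trIP v ξ) (trIP w ξ) :=
    gk_continuous.measurable.comp ((measurable_trIP v).prodMk (measurable_trIP w))
  exact ((h1.mul (measurable_entry l k)).mul hq).aestronglyMeasurable

theorem Tco_bound (κ : Measure (Mat d)) (q : Mat d → ℝ) {v w : Mat d}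
    (hv : v.PosSemidef) (hw : w.PosSemidef) (k l : Fin d) :
    ∀ᵐ ξ ∂(κ.restrict (coneNZ d)),
      ‖gk (trIP v ξ) (trIP w ξ) * ξ l k * q ξ‖ ≤ ‖ξ‖ * |q ξ| := by
  filter_upwards [ae_restrict_mem measurableSet_coneNZ] with ξ hξ
  have h1 := gk_bound (trIP_nonneg hv hξ.1) (trIP_nonneg hw hξ.1)
  have h2 := entry_le_norm ξ l k
  rw [Real.norm_eq_abs, abs_mul, abs_mul]
  gcongr
  calc |gk (trIP v ξ) (trIP w ξ)| * |ξ l k| ≤ 1 * ‖ξ‖ := by gcongr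
    _ = ‖ξ‖ := one_mul _

theorem Tco_continuous (κ : Measure (Mat d)) (q : Mat d → ℝ) (hq : Measurable q)
    (hqi : Integrable (fun ξ => ‖ξ‖ * |q ξ|) (κ.restrict (coneNZ d))) (k l : Fin d) :
    Continuous fun p : {u : Mat d | u.PosSemidef} × {u : Mat d | u.PosSemidef} =>
      Tco κ q p.1 p.2 k l := by
  have : FirstCountableTopology (Mat d) :=
    inferInstanceAs (FirstCountableTopology (Fin d → Fin d → ℝ))
  refine continuous_of_dominated (bound := fun ξ => ‖ξ‖ * |q ξ|) ?_ ?_ hqi ?_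
  · exact fun p => Tco_meas κ q hq _ _ k l
  · exact fun p => Tco_bound κ q p.1.2 p.2.2 k l
  · refine Eventually.of_forall fun ξ => ?_
    refine (Continuous.mul ?_ continuous_const).mul continuous_const
    refine gk_continuous.comp (f := fun p : {u : Mat d | u.PosSemidef} × {u : Mat d | u.PosSemidef} =>
      (trIP (p.1 : Mat d) ξ, trIP (p.2 : Mat d) ξ)) ?_
    exact ((continuous_trIP ξ).comp (continuous_subtype_val.comp continuous_fst)).prodMk
      ((continuous_trIP ξ).comp (continuous_subtype_val.comp continuous_snd))

theorem one_sub_exp_integrable (κ : Measure (Mat d)) (q : Mat d → ℝ) (hq : Measurable q)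
    (hqi : Integrable (fun ξ => ‖ξ‖ * |q ξ|) (κ.restrict (coneNZ d))) {v : Mat d}
    (hv : v.PosSemidef) :
    Integrable (fun ξ => (1 - Real.exp (-(trIP v ξ))) * q ξ) (κ.restrict (coneNZ d)) := by
  refine (hqi.const_mul (∑ k, ∑ l, |v k l|)).mono' ?_ ?_
  · have h1 := measurable_trIP v
    have : Measurable fun ξ => (1 - Real.exp (-(trIP v ξ))) * q ξ := by fun_prop
    exact this.aestronglyMeasurable
  · filter_upwards [ae_restrict_mem measurableSet_coneNZ] with ξ hξ
    have h0 := trIP_nonneg hv hξ.1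
    have h1 := exp_diff_bound le_rfl h0
    simp only [neg_zero, Real.exp_zero, sub_self, sub_zero] at h1
    rw [Real.norm_eq_abs, abs_mul, ← mul_assoc]
    gcongr
    refine h1.trans ?_
    rw [trIP_eq_sum, Finset.sum_mul]
    refine Finset.sum_le_sum fun k _ => ?_
    rw [Finset.sum_mul]
    refine Finset.sum_le_sum fun l _ => ?_
    refine (le_abs_self _).trans ?_
    rw [abs_mul]
    gcongr
    exact entry_le_norm ξ l k

theorem Tco_diff (κ : Measure (Mat d)) (q : Mat d → ℝ) (hq : Measurable q)
    (hqi : Integrable (fun ξ => ‖ξ‖ * |q ξ|) (κ.restrict (coneNZ d))) {v w : Mat d}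
    (hv : v.PosSemidef) (hw : w.PosSemidef) :
    (∫ ξ in coneNZ d, (1 - Real.exp (-(trIP v ξ))) * q ξ ∂κ) -
      (∫ ξ in coneNZ d, (1 - Real.exp (-(trIP w ξ))) * q ξ ∂κ) =
      ∑ k, ∑ l, (v - w) k l * Tco κ q v w k l := by
  rw [← integral_sub (one_sub_exp_integrable κ q hq hqi hv)
    (one_sub_exp_integrable κ q hq hqi hw)]
  have hTi : ∀ k l, Integrable (fun ξ => gk (trIP v ξ) (trIP w ξ) * ξ l k * q ξ)
      (κ.restrict (coneNZ d)) := fun k l =>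
    hqi.mono' (Tco_meas κ q hq v w k l) (Tco_bound κ q hv hw k l)
  have hR : ∑ k, ∑ l, (v - w) k l * Tco κ q v w k l = ∫ ξ in coneNZ d,
      ∑ k, ∑ l, (v - w) k l * (gk (trIP v ξ) (trIP w ξ) * ξ l k * q ξ) ∂κ := by
    rw [integral_finsetSum]
    · refine Finset.sum_congr rfl fun k _ => ?_
      rw [integral_finsetSum]
      · refine Finset.sum_congr rfl fun l _ => ?_
        rw [integral_const_mul]
        rfl
      · exact fun l _ => (hTi k l).const_mul _
    · intro k _
      exact integrable_finsetSum _ fun l _ => (hTi k l).const_mul _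
  rw [hR]
  refine integral_congr_ae (Eventually.of_forall fun ξ => ?_)
  have h1 := gk_eq (trIP v ξ) (trIP w ξ)
  have h2 : trIP v ξ - trIP w ξ = ∑ k, ∑ l, (v - w) k l * ξ l k := by
    rw [← trIP_eq_sum]
    simp only [trIP, sub_mul, Matrix.trace_sub]
  simp only
  rw [← sub_mul, ← h1, h2, Finset.sum_mul, Finset.sum_mul]
  refine Finset.sum_congr rfl fun k _ => ?_
  rw [Finset.sum_mul, Finset.sum_mul]
  refine Finset.sum_congr rfl fun l _ => ?_
  ring

/-- The linear functional with coefficients `T`. -/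
def Jlin (T : Fin d → Fin d → ℝ) : Mat d →ₗ[ℝ] ℝ where
  toFun h := ∑ k, ∑ l, h k l * T k l
  map_add' x y := by
    simp only [Matrix.add_apply, add_mul, Finset.sum_add_distrib]
  map_smul' c x := by
    simp only [Matrix.smul_apply, smul_eq_mul, mul_assoc, Finset.mul_sum, RingHom.id_apply]

/-- Hadamard quotient of `F`. -/
def Nlin (P : Admissible d) (v w : Mat d) : Mat d →ₗ[ℝ] ℝ where
  toFun h := trIP P.b h + Jlin (Tco P.m (fun _ => 1) v w) h
  map_add' x y := by
    simp only [trIP, mul_add, Matrix.trace_add, map_add]; ring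
  map_smul' c x := by
    simp only [trIP, Matrix.mul_smul, Matrix.trace_smul, map_smul, smul_eq_mul, RingHom.id_apply]
    ring

/-- Hadamard quotient of `R`. -/
def Mlin (P : Admissible d) (v w : Mat d) : Mat d →ₗ[ℝ] Mat d where
  toFun h := (-2 : ℝ) • (v * P.α * h + h * P.α * w) + P.Bt h +
    Matrix.of fun i j => Jlin (Tco P.ν (fun ξ => P.ρ ξ i j) v w) h
  map_add' x y := by
    ext i j
    simp only [mul_add, add_mul, map_add, Matrix.add_apply, Matrix.smul_apply, Matrix.of_apply,
      smul_eq_mul]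
    ring
  map_smul' c x := by
    ext i j
    simp only [Matrix.mul_smul, Matrix.smul_mul, map_smul, Matrix.add_apply, Matrix.smul_apply,
      Matrix.of_apply, smul_eq_mul, RingHom.id_apply]
    ring

theorem m_integrable (P : Admissible d)
    (hmom : IntegrableOn (fun ξ : Mat d => ‖ξ‖) (coneNZ d ∩ {ξ : Mat d | 1 < ‖ξ‖}) P.m) :
    Integrable (fun ξ : Mat d => ‖ξ‖ * |(1 : ℝ)|) (P.m.restrict (coneNZ d)) := by
  simp only [abs_one, mul_one]
  have hms : MeasurableSet {ξ : Mat d | ‖ξ‖ ≤ 1} := measurableSet_le measurable_norm_mat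
    measurable_const
  have h1 : IntegrableOn (fun ξ : Mat d => ‖ξ‖) (coneNZ d ∩ {ξ : Mat d | ‖ξ‖ ≤ 1}) P.m := by
    refine (P.hm.mono_set Set.inter_subset_left).congr_fun ?_ (measurableSet_coneNZ.inter hms)
    intro ξ hξ
    exact min_eq_left hξ.2
  have h2 := h1.union hmom
  rw [← Set.inter_union_distrib_left] at h2
  refine IntegrableOn.mono_set h2 fun ξ hξ => ⟨hξ, ?_⟩
  exact le_or_gt ‖ξ‖ 1

theorem nu_integrable (P : Admissible d) (i j : Fin d) :
    Integrable (fun ξ : Mat d => ‖ξ‖ * |P.ρ ξ i j|) (P.ν.restrict (coneNZ d)) := by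
  refine P.hμint.mono' ?_ ?_
  · exact (measurable_norm_mat.mul
      ((measurable_entry i j).comp P.hρmeas).abs).aestronglyMeasurable
  · filter_upwards [P.hρpsd] with ξ hξ
    rw [Real.norm_eq_abs, abs_mul, abs_abs, abs_of_nonneg (norm_nonneg ξ)]
    exact mul_le_mul_of_nonneg_left (entry_le_trace hξ i j) (norm_nonneg ξ)

theorem F_diff (P : Admissible d)
    (hmom : IntegrableOn (fun ξ : Mat d => ‖ξ‖) (coneNZ d ∩ {ξ : Mat d | 1 < ‖ξ‖}) P.m)
    {v w : Mat d} (hv : v.PosSemidef) (hw : w.PosSemidef) :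
    Ffun P.b P.m v - Ffun P.b P.m w = Nlin P v w (v - w) := by
  have h := Tco_diff P.m (fun _ => 1) measurable_const (m_integrable P hmom) hv hw
  simp only [mul_one] at h
  have h2 : trIP P.b (v - w) = trIP P.b v - trIP P.b w := by
    simp only [trIP, mul_sub, Matrix.trace_sub]
  change _ = trIP P.b (v - w) + ∑ k, ∑ l, (v - w) k l * Tco P.m (fun _ => 1) v w k l
  rw [← h, h2, Ffun, Ffun]
  ring

theorem R_diff (P : Admissible d) {v w : Mat d} (hv : v.PosSemidef) (hw : w.PosSemidef) :
    Rfun P.α P.Bt P.ν P.ρ v - Rfun P.α P.Bt P.ν P.ρ w = Mlin P v w (v - w) := by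
  have hmu : muInt P.ν P.ρ (fun ξ => Real.exp (-(trIP w ξ)) - 1) -
      muInt P.ν P.ρ (fun ξ => Real.exp (-(trIP v ξ)) - 1) =
      Matrix.of fun i j => Jlin (Tco P.ν (fun ξ => P.ρ ξ i j) v w) (v - w) := by
    ext i j
    have h := Tco_diff P.ν (fun ξ => P.ρ ξ i j) ((measurable_entry i j).comp P.hρmeas)
      (nu_integrable P i j) hv hw
    have h3 : ∀ u : Mat d, ∫ ξ in coneNZ d, (Real.exp (-(trIP u ξ)) - 1) * P.ρ ξ i j ∂P.ν =
        - ∫ ξ in coneNZ d, (1 - Real.exp (-(trIP u ξ))) * P.ρ ξ i j ∂P.ν := by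
      intro u
      rw [← integral_neg]
      congr 1
      funext ξ
      ring
    simp only [Matrix.sub_apply, muInt, Matrix.of_apply, h3]
    refine Eq.trans ?_ h
    ring
  change _ = (-2 : ℝ) • (v * P.α * (v - w) + (v - w) * P.α * w) + P.Bt (v - w) +
    Matrix.of fun i j => Jlin (Tco P.ν (fun ξ => P.ρ ξ i j) v w) (v - w)
  rw [← hmu, Rfun, Rfun, map_sub]
  have : v * P.α * (v - w) + (v - w) * P.α * w = v * P.α * v - w * P.α * w := by noncomm_ring
  rw [this, smul_sub]
  abel

theorem Jlin_cont {Y : Type*} [TopologicalSpace Y] (T : Y → Fin d → Fin d → ℝ)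
    (hT : ∀ k l, Continuous fun p => T p k l) (h : Mat d) : Continuous fun p => Jlin (T p) h := by
  change Continuous fun p => ∑ k, ∑ l, h k l * T p k l
  exact continuous_finsetSum _ fun k _ => continuous_finsetSum _ fun l _ =>
    continuous_const.mul (hT k l)

theorem N_cont (P : Admissible d)
    (hmom : IntegrableOn (fun ξ : Mat d => ‖ξ‖) (coneNZ d ∩ {ξ : Mat d | 1 < ‖ξ‖}) P.m)
    (h : Mat d) :
    Continuous fun p : {u : Mat d | u.PosSemidef} × {u : Mat d | u.PosSemidef} =>
      Nlin P p.1 p.2 h :=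
  continuous_const.add (Jlin_cont _ (fun k l =>
    Tco_continuous P.m (fun _ => 1) measurable_const (m_integrable P hmom) k l) h)

theorem M_cont (P : Admissible d) (h : Mat d) :
    Continuous fun p : {u : Mat d | u.PosSemidef} × {u : Mat d | u.PosSemidef} =>
      Mlin P p.1 p.2 h := by
  have h1 : Continuous fun p : {u : Mat d | u.PosSemidef} × {u : Mat d | u.PosSemidef} =>
      (Matrix.of fun i j => Jlin (Tco P.ν (fun ξ => P.ρ ξ i j) p.1 p.2) h : Mat d) :=
    continuous_matrix fun i j => Jlin_cont _ (fun k l =>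
      Tco_continuous P.ν (fun ξ => P.ρ ξ i j) ((measurable_entry i j).comp P.hρmeas)
        (nu_integrable P i j) k l) h
  refine Continuous.add (Continuous.add ?_ continuous_const) h1
  have hv : Continuous fun p : {u : Mat d | u.PosSemidef} × {u : Mat d | u.PosSemidef} =>
      (p.1 : Mat d) := continuous_subtype_val.comp continuous_fst
  have hw : Continuous fun p : {u : Mat d | u.PosSemidef} × {u : Mat d | u.PosSemidef} =>
      (p.2 : Mat d) := continuous_subtype_val.comp continuous_snd
  have h2 : Continuous fun p : {u : Mat d | u.PosSemidef} × {u : Mat d | u.PosSemidef} =>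
      (p.1 : Mat d) * P.α * h + h * P.α * (p.2 : Mat d) := by fun_prop
  exact h2.const_smul (-2 : ℝ)

end ConcretePart

/-- Proposition 3.3 (b): if `∫_{‖ξ‖>1} ‖ξ‖ m(dξ) < ∞`, then the space derivative `Dφ(t,·)` of
`φ(t,u) = ∫_0^t F(ψ(s,u)) ds` (which exists on `S_d^{++}`) has a jointly continuous extension
`E` to `[0,∞) × S_d^+`. -/
theorem Dphi_jointly_continuous_extension
    (d : ℕ) (hd : 2 ≤ d) (P : Admissible d)
    (ψ : ℝ → Mat d → Mat d) (hψ : IsRiccati P ψ)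
    (hmom : IntegrableOn (fun ξ : Mat d => ‖ξ‖) (coneNZ d ∩ {ξ : Mat d | 1 < ‖ξ‖}) P.m)
    (hcont : ContinuousOn (fun q : ℝ × Mat d => ψ q.1 q.2)
      (Set.Ici 0 ×ˢ {u : Mat d | u.PosSemidef}))
    (hzero : ∀ t : ℝ, 0 ≤ t → ψ t 0 = 0)
    (Dψ : ℝ → Mat d → (Mat d →L[ℝ] Mat d))
    (hDψ : ∀ t : ℝ, 0 ≤ t → ∀ u : Mat d, u.PosDef →
      HasFDerivWithinAt (ψ t) (Dψ t u) {v : Mat d | v.PosSemidef} u) :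
    ∃ E : ℝ → Mat d → (Mat d →L[ℝ] ℝ),
      ContinuousOn (fun q : ℝ × Mat d => E q.1 q.2)
        (Set.Ici 0 ×ˢ {u : Mat d | u.PosSemidef}) ∧
      (∀ t : ℝ, 0 ≤ t → ∀ u : Mat d, u.PosDef →
        HasFDerivWithinAt (fun v => phiFun P ψ t v) (E t u)
          {v : Mat d | v.PosSemidef} u) := by
  obtain ⟨hψ0, hψK, hψ'⟩ := hψ
  obtain ⟨E, hE1, hE2⟩ := abstract_main (V := Mat d) {u : Mat d | u.PosSemidef} isClosed_psd
    (Rfun P.α P.Bt P.ν P.ρ) (Ffun P.b P.m) (fun v w => Mlin P v w) (M_cont P)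
    (fun v w => R_diff P v.2 w.2) (fun v w => Nlin P v w) (N_cont P hmom)
    (fun v w => F_diff P hmom v.2 w.2) ψ hψ0 hψK hψ' hcont
  exact ⟨E, hE1, fun t ht u hu => hE2 t ht u hu.posSemidef⟩
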